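/- A totally ordered triplet (X,Y,Z) of random variables on a common finite probability space is geodesic, i.e. V(X,Z) = V(X,Y) + V(Y,Z), if and only if H(Y|(X,Z)) = 0 and I(X;Z|Y) = 0 (that is, Y is determined by (X,Z) and X, Z are conditionally independent given Y). -/

import Mathlib

open Finset

structure FinProb (Ω : Type*) [Fintype Ω] where
  p : Ω → ℝ
  nonneg : ∀ ω, 0 ≤ p ω
  sum_one : ∑ ω, p ω = 1

noncomputable def pmf {Ω α : Type*} [Fintype Ω] [DecidableEq α]
    (P : FinProb Ω) (X : Ω → α) (x : α) : ℝ :=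
  ∑ ω ∈ Finset.univ.filter (fun ω => X ω = x), P.p ω

noncomputable def ent {Ω α : Type*} [Fintype Ω] [Fintype α] [DecidableEq α]
    (c : ℝ) (P : FinProb Ω) (X : Ω → α) : ℝ :=
  -∑ x : α, pmf P X x * Real.logb c (pmf P X x)

noncomputable def jent2 {Ω α β : Type*} [Fintype Ω] [Fintype α] [DecidableEq α]
    [Fintype β] [DecidableEq β] (c : ℝ) (P : FinProb Ω) (X : Ω → α) (Y : Ω → β) : ℝ :=
  ent c P (fun ω => (X ω, Y ω))

noncomputable def jent3 {Ω α β γ : Type*} [Fintype Ω] [Fintype α] [DecidableEq α]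
    [Fintype β] [DecidableEq β] [Fintype γ] [DecidableEq γ]
    (c : ℝ) (P : FinProb Ω) (X : Ω → α) (Y : Ω → β) (Z : Ω → γ) : ℝ :=
  ent c P (fun ω => (X ω, Y ω, Z ω))

noncomputable def mi {Ω α β : Type*} [Fintype Ω] [Fintype α] [DecidableEq α]
    [Fintype β] [DecidableEq β] (c : ℝ) (P : FinProb Ω) (X : Ω → α) (Y : Ω → β) : ℝ :=
  ent c P X + ent c P Y - jent2 c P X Y

noncomputable def infoDist {Ω α β : Type*} [Fintype Ω] [Fintype α] [DecidableEq α]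
    [Fintype β] [DecidableEq β] (c : ℝ) (P : FinProb Ω) (X : Ω → α) (Y : Ω → β) : ℝ :=
  jent2 c P X Y - mi c P X Y

/-- Conditional entropy `H(X|Y)`. -/
noncomputable def condEnt {Ω α β : Type*} [Fintype Ω] [Fintype α] [DecidableEq α]
    [Fintype β] [DecidableEq β] (c : ℝ) (P : FinProb Ω) (X : Ω → α) (Y : Ω → β) : ℝ :=
  jent2 c P X Y - ent c P Y

/-- Conditional mutual information `I(X;Z|Y)`. -/
noncomputable def cmi {Ω α β γ : Type*} [Fintype Ω] [Fintype α] [DecidableEq α]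
    [Fintype β] [DecidableEq β] [Fintype γ] [DecidableEq γ]
    (c : ℝ) (P : FinProb Ω) (X : Ω → α) (Z : Ω → γ) (Y : Ω → β) : ℝ :=
  jent2 c P X Y + jent2 c P Y Z - ent c P Y - jent3 c P X Y Z

theorem sum_fiber {Ω α : Type*} [Fintype Ω] [Fintype α] [DecidableEq α]
    (P : FinProb Ω) (X : Ω → α) (f : α → ℝ) :
    ∑ x, pmf P X x * f x = ∑ ω, P.p ω * f (X ω) := by
  rw [← Finset.sum_fiberwise (s := Finset.univ) (g := X)]
  refine Finset.sum_congr rfl fun x _ => ?_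
  rw [pmf, Finset.sum_mul]
  refine Finset.sum_congr rfl fun ω hω => ?_
  rw [(Finset.mem_filter.mp hω).2]

theorem ent_eq {Ω α : Type*} [Fintype Ω] [Fintype α] [DecidableEq α]
    (c : ℝ) (P : FinProb Ω) (X : Ω → α) :
    ent c P X = -∑ ω, P.p ω * Real.logb c (pmf P X (X ω)) := by
  rw [ent, sum_fiber P X (fun x => Real.logb c (pmf P X x))]

theorem pmf_nonneg {Ω α : Type*} [Fintype Ω] [DecidableEq α]
    (P : FinProb Ω) (X : Ω → α) (x : α) : 0 ≤ pmf P X x :=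
  Finset.sum_nonneg fun ω _ => P.nonneg ω

theorem pmf_pos {Ω α : Type*} [Fintype Ω] [DecidableEq α]
    (P : FinProb Ω) (X : Ω → α) (ω : Ω) (h : 0 < P.p ω) : 0 < pmf P X (X ω) :=
  lt_of_lt_of_le h
    (Finset.single_le_sum (f := P.p) (fun ω _ => P.nonneg ω) (by simp))

theorem pmf_le {Ω α β : Type*} [Fintype Ω] [DecidableEq α] [DecidableEq β]
    (P : FinProb Ω) (X : Ω → α) (Y : Ω → β) (x : α) (y : β)
    (h : ∀ ω, X ω = x → Y ω = y) : pmf P X x ≤ pmf P Y y := by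
  refine Finset.sum_le_sum_of_subset_of_nonneg ?_ (fun ω _ _ => P.nonneg ω)
  intro ω hω
  simp only [Finset.mem_filter, Finset.mem_univ, true_and] at hω ⊢
  exact h ω hω

theorem marg_left {Ω α β : Type*} [Fintype Ω] [Fintype α] [DecidableEq α] [DecidableEq β]
    (P : FinProb Ω) (X : Ω → α) (Y : Ω → β) (y : β) :
    ∑ x, pmf P (fun ω => (X ω, Y ω)) (x, y) = pmf P Y y := by
  simp only [pmf, Finset.sum_filter, Prod.mk.injEq]
  rw [Finset.sum_comm]
  refine Finset.sum_congr rfl fun ω _ => ?_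
  by_cases h : Y ω = y <;> simp [h]

theorem marg_right {Ω α β : Type*} [Fintype Ω] [Fintype β] [DecidableEq α] [DecidableEq β]
    (P : FinProb Ω) (X : Ω → α) (Y : Ω → β) (x : α) :
    ∑ y, pmf P (fun ω => (X ω, Y ω)) (x, y) = pmf P X x := by
  simp only [pmf, Finset.sum_filter, Prod.mk.injEq]
  rw [Finset.sum_comm]
  refine Finset.sum_congr rfl fun ω _ => ?_
  by_cases h : X ω = x <;> simp [h]

theorem pmf_total {Ω α : Type*} [Fintype Ω] [Fintype α] [DecidableEq α]
    (P : FinProb Ω) (X : Ω → α) : ∑ x, pmf P X x = 1 := by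
  have := sum_fiber P X (fun _ => 1)
  simpa [P.sum_one] using this

theorem ent_mono {Ω α β : Type*} [Fintype Ω] [Fintype α] [DecidableEq α]
    [Fintype β] [DecidableEq β] (c : ℝ) (hc : 1 < c) (P : FinProb Ω) (X : Ω → α) (Y : Ω → β)
    (h : ∀ ω ω', X ω = X ω' → Y ω = Y ω') : ent c P Y ≤ ent c P X := by
  rw [ent_eq, ent_eq]
  apply neg_le_neg
  refine Finset.sum_le_sum fun ω _ => ?_
  rcases (P.nonneg ω).eq_or_lt with h0 | h0
  · simp [← h0]
  · refine mul_le_mul_of_nonneg_left ?_ h0.le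
    exact Real.logb_le_logb_of_le hc (pmf_pos P X ω h0) (pmf_le P X Y _ _ fun ω' => h ω' ω)

theorem cmi_nonneg {Ω α β γ : Type*} [Fintype Ω] [Fintype α] [DecidableEq α]
    [Fintype β] [DecidableEq β] [Fintype γ] [DecidableEq γ]
    (c : ℝ) (hc : 1 < c) (P : FinProb Ω) (X : Ω → α) (Y : Ω → β) (Z : Ω → γ) :
    0 ≤ cmi c P X Z Y := by
  have hlc : 0 < Real.log c := Real.log_pos hc
  let A : α → β → ℝ := fun x y => pmf P (fun ω => (X ω, Y ω)) (x, y)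
  let B : β → γ → ℝ := fun y z => pmf P (fun ω => (Y ω, Z ω)) (y, z)
  let D : β → ℝ := fun y => pmf P Y y
  let T : α × β × γ → ℝ := fun t => pmf P (fun ω => (X ω, Y ω, Z ω)) t
  let f : α × β × γ → ℝ := fun t => A t.1 t.2.1 * B t.2.1 t.2.2 / (T t * D t.2.1)
  have key : ∑ ω, P.p ω * f (X ω, Y ω, Z ω) ≤ 1 := by
    rw [← sum_fiber P (fun ω => (X ω, Y ω, Z ω)) f]
    calc ∑ t, pmf P (fun ω => (X ω, Y ω, Z ω)) t * f t
        ≤ ∑ t : α × β × γ, A t.1 t.2.1 * B t.2.1 t.2.2 / D t.2.1 := by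
          refine Finset.sum_le_sum fun t _ => ?_
          have hn : 0 ≤ A t.1 t.2.1 * B t.2.1 t.2.2 / D t.2.1 :=
            div_nonneg (mul_nonneg (pmf_nonneg _ _ _) (pmf_nonneg _ _ _)) (pmf_nonneg _ _ _)
          change T t * (A t.1 t.2.1 * B t.2.1 t.2.2 / (T t * D t.2.1)) ≤ _
          by_cases hT : T t = 0
          · rw [hT, zero_mul]; exact hn
          · apply le_of_eq
            rw [mul_comm (T t) (D _), ← div_div]
            exact mul_div_cancel₀ _ hT
      _ = ∑ y, D y := by
          rw [Fintype.sum_prod_type_right]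
          simp only [Fintype.sum_prod_type]
          refine Finset.sum_congr rfl fun y _ => ?_
          simp only [← Finset.sum_div, ← Finset.sum_mul, ← Finset.mul_sum]
          have h1 : ∑ x, A x y = D y := marg_left P X Y y
          have h2 : ∑ z, B y z = D y := marg_right P Y Z y
          rw [h1, h2, mul_self_div_self]
      _ = 1 := pmf_total P Y
  have main : ∑ ω, P.p ω * (Real.logb c (A (X ω) (Y ω)) + Real.logb c (B (Y ω) (Z ω))
      - Real.logb c (T (X ω, Y ω, Z ω)) - Real.logb c (D (Y ω))) ≤
      ∑ ω, P.p ω * ((f (X ω, Y ω, Z ω) - 1) / Real.log c) := by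
    refine Finset.sum_le_sum fun ω _ => ?_
    rcases (P.nonneg ω).eq_or_lt with h0 | h0
    · simp [← h0]
    · refine mul_le_mul_of_nonneg_left ?_ h0.le
      have hA : 0 < A (X ω) (Y ω) := pmf_pos P (fun ω => (X ω, Y ω)) ω h0
      have hB : 0 < B (Y ω) (Z ω) := pmf_pos P (fun ω => (Y ω, Z ω)) ω h0
      have hT : 0 < T (X ω, Y ω, Z ω) := pmf_pos P (fun ω => (X ω, Y ω, Z ω)) ω h0
      have hD : 0 < D (Y ω) := pmf_pos P Y ω h0
      have hf : Real.log (f (X ω, Y ω, Z ω)) ≤ f (X ω, Y ω, Z ω) - 1 :=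
        Real.log_le_sub_one_of_pos (div_pos (mul_pos hA hB) (mul_pos hT hD))
      have he : Real.log (f (X ω, Y ω, Z ω)) = Real.log (A (X ω) (Y ω)) +
          Real.log (B (Y ω) (Z ω)) - (Real.log (T (X ω, Y ω, Z ω)) + Real.log (D (Y ω))) := by
        change Real.log (A (X ω) (Y ω) * B (Y ω) (Z ω) / (T (X ω, Y ω, Z ω) * D (Y ω))) = _
        rw [Real.log_div (mul_pos hA hB).ne' (mul_pos hT hD).ne',
          Real.log_mul hA.ne' hB.ne', Real.log_mul hT.ne' hD.ne']
      simp only [Real.logb, ← add_div, ← sub_div]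
      apply div_le_div_of_nonneg_right _ hlc.le
      linarith
  have hr : ∑ ω, P.p ω * ((f (X ω, Y ω, Z ω) - 1) / Real.log c) ≤ 0 := by
    simp only [← mul_div_assoc, ← Finset.sum_div, mul_sub, Finset.sum_sub_distrib, mul_one,
      P.sum_one]
    exact div_nonpos_of_nonpos_of_nonneg (by linarith) hlc.le
  have hm := main.trans hr
  simp only [mul_add, mul_sub, Finset.sum_sub_distrib, Finset.sum_add_distrib] at hm
  rw [cmi, jent2, jent2, jent3, ent_eq, ent_eq, ent_eq, ent_eq]
  simp only [A, B, D, T] at hm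
  linarith

/-- `(X,Y,Z)` is geodesic, i.e. `V(X,Z) = V(X,Y) + V(Y,Z)`, iff
`H(Y|(X,Z)) = 0` and `I(X;Z|Y) = 0`. -/
theorem geodesic_iff {Ω α β γ : Type*} [Fintype Ω] [Fintype α] [DecidableEq α]
    [Fintype β] [DecidableEq β] [Fintype γ] [DecidableEq γ]
    (c : ℝ) (hc : 1 < c) (P : FinProb Ω) (X : Ω → α) (Y : Ω → β) (Z : Ω → γ) :
    infoDist c P X Z = infoDist c P X Y + infoDist c P Y Z ↔
      condEnt c P Y (fun ω => (X ω, Z ω)) = 0 ∧ cmi c P X Z Y = 0 := by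
  have h1 := cmi_nonneg c hc P X Y Z
  have e1 : jent3 c P X Y Z = jent2 c P Y (fun ω => (X ω, Z ω)) := by
    apply le_antisymm
    · apply ent_mono c hc P
      intro ω ω' h
      simp only [Prod.mk.injEq] at h ⊢
      tauto
    · apply ent_mono c hc P
      intro ω ω' h
      simp only [Prod.mk.injEq] at h ⊢
      tauto
  have h2 : 0 ≤ condEnt c P Y (fun ω => (X ω, Z ω)) := by
    apply sub_nonneg.mpr
    apply ent_mono c hc P
    intro ω ω' h
    exact (Prod.mk.injEq _ _ _ _ ▸ h).2
  have e2 : infoDist c P X Y + infoDist c P Y Z - infoDist c P X Z =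
      2 * (condEnt c P Y (fun ω => (X ω, Z ω)) + cmi c P X Z Y) := by
    rw [condEnt, cmi, e1]
    simp only [infoDist, mi]
    change _ = 2 * (_ - jent2 c P X Z + _)
    ring
  constructor
  · intro h
    constructor <;> linarith
  · rintro ⟨h, h'⟩
    linarith
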